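/- Let P be a Perron system, 𝔓⁻ the associated family of unions of consecutive P⁻-cylinders, and 𝔓₁⁻ ⊆ 𝔓⁻ the subfamily of all finite unions of consecutive P⁻-cylinders of the same rank contained in a single P⁻-cylinder of the previous rank (i.e. the unions with m < ∞). Then H^α(E, 𝔓₁⁻) = H^α(E, 𝔓⁻) for every set E ⊆ (0,1) \ IS^{P⁻} and every α > 0, and 𝔓₁⁻ is a faithful family of coverings for the Hausdorff dimension calculation on (0,1) \ IS^{P⁻}. -/

import Mathlib

open Set Filter MeasureTheory
open scoped ENNReal

noncomputable section

/-- A Perron system `P = (φ_n)`: `φ₀ = φ []` and `φ_n(c₁,…,c_n) = φ [c₁,…,c_n]`;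
all values are positive integers. -/
structure PerronSystem where
  φ : List ℕ → ℕ
  φ_pos : ∀ l, 0 < φ l

/-- `(c₁−1)c₁⋯(c_n−1)c_n` (0-based indexing: `c 0 = c₁`). -/
def qprod (c : ℕ → ℕ) (n : ℕ) : ℝ :=
  ∏ i ∈ Finset.range n, (((c i : ℝ) - 1) * (c i : ℝ))

namespace PerronSystem

variable (P : PerronSystem)

/-- `r P c 0 = φ₀` and `r P c n = φ_n(c₁,…,c_n)`. -/
def r (c : ℕ → ℕ) (n : ℕ) : ℕ := P.φ (List.ofFn fun j : Fin n => c j)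

/-- The word `c₁ … c_k` is P-admissible: `c_i ≥ φ_{i−1}(c₁,…,c_{i−1}) + 1`. -/
def AdmissibleUpTo (c : ℕ → ℕ) (k : ℕ) : Prop := ∀ i < k, P.r c i + 1 ≤ c i

/-- The infinite digit sequence `c` is P-admissible. -/
def Admissible (c : ℕ → ℕ) : Prop := ∀ i, P.r c i + 1 ≤ c i

/-- `r₀ r₁ ⋯ r_{n−1}`. -/
def rprod (c : ℕ → ℕ) (n : ℕ) : ℝ := ∏ i ∈ Finset.range n, (P.r c i : ℝ)

/-- Diameter `D_k = r₀⋯r_{k−1} / ((c₁−1)c₁⋯(c_k−1)c_k)` of the cylinder with base `c₁…c_k`. -/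
def D (c : ℕ → ℕ) (k : ℕ) : ℝ := P.rprod c k / qprod c k

/-- `S_k`, the infimum of the positive Perron cylinder with base `c₁…c_k`. -/
def S (c : ℕ → ℕ) (k : ℕ) : ℝ :=
  ∑ n ∈ Finset.range k, P.rprod c (n + 1) / (qprod c n * (c n : ℝ))

/-- The positive Perron cylinder `Δ^P_{c₁…c_k} = (S_k, S_k + D_k]`. -/
def cyl (c : ℕ → ℕ) (k : ℕ) : Set ℝ := Ioc (P.S c k) (P.S c k + P.D c k)

/-- `A_k = ∑_{n=0}^{k−1} (−1)^n r₀⋯r_n / ((c₁−1)c₁⋯(c_n−1)c_n (c_{n+1}−1))`. -/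
def A (c : ℕ → ℕ) (k : ℕ) : ℝ :=
  ∑ n ∈ Finset.range k, (-1 : ℝ) ^ n * P.rprod c (n + 1) / (qprod c n * ((c n : ℝ) - 1))

/-- The second endpoint `A_k + (−1)^k D_k` of the interval `I_{c₁…c_k}`. -/
def altEnd (c : ℕ → ℕ) (k : ℕ) : ℝ := P.A c k + (-1 : ℝ) ^ k * P.D c k

/-- The countable set `IS^{P⁻}` of endpoints of the intervals `I_{c₁…c_k}`
(the word of length `0` contributes the endpoints `0` and `1`). -/
def IS : Set ℝ :=
  {x | ∃ (c : ℕ → ℕ) (k : ℕ), P.AdmissibleUpTo c k ∧ (x = P.A c k ∨ x = P.altEnd c k)}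

/-- The alternating Perron cylinder `Δ^{P⁻}_{c₁…c_k} = I_{c₁…c_k} \ IS^{P⁻}`. -/
def altCyl (c : ℕ → ℕ) (k : ℕ) : Set ℝ :=
  Ioo (min (P.A c k) (P.altEnd c k)) (max (P.A c k) (P.altEnd c k)) \ P.IS

/-- The family `𝔓` of all unions of consecutive positive Perron cylinders of the same
rank contained in a single cylinder of the previous rank. -/
def famP : Set (Set ℝ) :=
  {U | ∃ (c : ℕ → ℕ) (k n : ℕ), P.AdmissibleUpTo c k ∧ P.r c k + 1 ≤ n ∧
      ((∃ m, n ≤ m ∧ U = ⋃ i ∈ Finset.Icc n m, P.cyl (Function.update c k i) (k + 1)) ∨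
        U = ⋃ i ∈ {j : ℕ | n ≤ j}, P.cyl (Function.update c k i) (k + 1))}

/-- The subfamily `𝔓₁ ⊆ 𝔓` of finite unions. -/
def famP1 : Set (Set ℝ) :=
  {U | ∃ (c : ℕ → ℕ) (k n m : ℕ), P.AdmissibleUpTo c k ∧ P.r c k + 1 ≤ n ∧ n ≤ m ∧
      U = ⋃ i ∈ Finset.Icc n m, P.cyl (Function.update c k i) (k + 1)}

/-- The family `𝔓⁻` of all unions of consecutive alternating Perron cylinders of the same
rank contained in a single cylinder of the previous rank. -/
def famAlt : Set (Set ℝ) :=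
  {U | ∃ (c : ℕ → ℕ) (k n : ℕ), P.AdmissibleUpTo c k ∧ P.r c k + 1 ≤ n ∧
      ((∃ m, n ≤ m ∧ U = ⋃ i ∈ Finset.Icc n m, P.altCyl (Function.update c k i) (k + 1)) ∨
        U = ⋃ i ∈ {j : ℕ | n ≤ j}, P.altCyl (Function.update c k i) (k + 1))}

/-- The subfamily `𝔓₁⁻ ⊆ 𝔓⁻` of finite unions. -/
def famAlt1 : Set (Set ℝ) :=
  {U | ∃ (c : ℕ → ℕ) (k n m : ℕ), P.AdmissibleUpTo c k ∧ P.r c k + 1 ≤ n ∧ n ≤ m ∧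
      U = ⋃ i ∈ Finset.Icc n m, P.altCyl (Function.update c k i) (k + 1)}

/-- The value `Δ^P_c` of the positive Perron expansion with digit sequence `c`. -/
def posValue (c : ℕ → ℕ) : ℝ :=
  ∑' n : ℕ, P.rprod c (n + 1) / (qprod c n * (c n : ℝ))

/-- The value `Δ^{P⁻}_c` of the alternating Perron expansion with digit sequence `c`. -/
def altValue (c : ℕ → ℕ) : ℝ :=
  ∑' n : ℕ, (-1 : ℝ) ^ n * P.rprod c (n + 1) / (qprod c n * ((c n : ℝ) - 1))

end PerronSystem

/-- The Hausdorff `α`-dimensional measure of `E` with respect to a family of coverings `Φ`. -/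
def Hfam (Φ : Set (Set ℝ)) (α : ℝ) (E : Set ℝ) : ℝ≥0∞ :=
  ⨆ (ε : ℝ) (_ : 0 < ε),
    ⨅ (f : ℕ → Set ℝ) (_ : E ⊆ ⋃ n, f n) (_ : ∀ n, f n ∈ Φ)
      (_ : ∀ n, EMetric.diam (f n) ≤ ENNReal.ofReal ε),
      ∑' n : ℕ, EMetric.diam (f n) ^ α

/-- The Hausdorff dimension of `E` with respect to a family of coverings `Φ`:
`inf {α > 0 : H^α(E, Φ) = 0}` (equal to `∞` if no such `α` exists). -/
def dimFam (Φ : Set (Set ℝ)) (E : Set ℝ) : ℝ≥0∞ :=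
  ⨅ (α : ℝ) (_ : 0 < α) (_ : Hfam Φ α E = 0), ENNReal.ofReal α

end

namespace PerronSystem

variable (P : PerronSystem)

/-- normalized coordinate on a cylinder -/
noncomputable def TT (c : ℕ → ℕ) (k : ℕ) (t : ℝ) : ℝ := P.A c k + (-1 : ℝ) ^ k * P.D c k * t

theorem r_pos (c : ℕ → ℕ) (k : ℕ) : (1 : ℝ) ≤ (P.r c k : ℝ) := by
  have : 0 < P.r c k := P.φ_pos _
  exact_mod_cast this

theorem r_congr {c c' : ℕ → ℕ} {k : ℕ} (h : ∀ j < k, c j = c' j) : P.r c k = P.r c' k := by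
  unfold r
  congr 2
  funext j
  exact h j j.2

theorem r_update (c : ℕ → ℕ) {k j : ℕ} (i : ℕ) (h : j ≤ k) :
    P.r (Function.update c k i) j = P.r c j := by
  apply r_congr
  intro l hl
  rw [Function.update_of_ne (by omega)]

theorem adm_update {c : ℕ → ℕ} {k i : ℕ} (h : P.AdmissibleUpTo c k) (hi : P.r c k + 1 ≤ i) :
    P.AdmissibleUpTo (Function.update c k i) (k + 1) := by
  intro j hj
  rw [P.r_update c i (by omega)]
  rcases Nat.lt_succ_iff_lt_or_eq.1 hj with h1 | h1
  · rw [Function.update_of_ne (by omega)]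
    exact h j h1
  · subst h1
    simpa using hi

theorem rprod_update (c : ℕ → ℕ) {k j : ℕ} (i : ℕ) (h : j ≤ k + 1) :
    P.rprod (Function.update c k i) j = P.rprod c j := by
  unfold rprod
  refine Finset.prod_congr rfl fun l hl => ?_
  rw [Finset.mem_range] at hl
  rw [P.r_update c i (by omega)]

theorem qprod_update (c : ℕ → ℕ) {k j : ℕ} (i : ℕ) (h : j ≤ k) :
    qprod (Function.update c k i) j = qprod c j := by
  unfold qprod
  refine Finset.prod_congr rfl fun l hl => ?_
  rw [Finset.mem_range] at hl
  rw [Function.update_of_ne (by omega)]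

theorem D_update (c : ℕ → ℕ) (k i : ℕ) :
    P.D (Function.update c k i) (k + 1) = P.D c k * (P.r c k / (((i : ℝ) - 1) * i)) := by
  unfold D
  rw [P.rprod_update c i le_rfl]
  have : qprod (Function.update c k i) (k + 1) = qprod c k * (((i : ℝ) - 1) * i) := by
    conv_lhs => unfold qprod
    rw [Finset.prod_range_succ]
    have := qprod_update c i (le_refl k)
    unfold qprod at this
    rw [this]
    simp [qprod]
  rw [this]
  have : P.rprod c (k + 1) = P.rprod c k * P.r c k := by
    unfold rprod
    rw [Finset.prod_range_succ]
  rw [this, mul_div_mul_comm]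

theorem A_update (c : ℕ → ℕ) (k i : ℕ) :
    P.A (Function.update c k i) (k + 1) = P.TT c k (P.r c k / ((i : ℝ) - 1)) := by
  unfold A TT
  rw [Finset.sum_range_succ]
  have h1 : ∑ n ∈ Finset.range k, (-1 : ℝ) ^ n * P.rprod (Function.update c k i) (n + 1) /
      (qprod (Function.update c k i) n * (((Function.update c k i) n : ℝ) - 1)) = P.A c k := by
    unfold A
    refine Finset.sum_congr rfl fun l hl => ?_
    rw [Finset.mem_range] at hl
    rw [P.rprod_update c i (by omega), qprod_update c i (by omega),
      Function.update_of_ne (by omega)]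
  rw [h1]
  congr 1
  rw [P.rprod_update c i le_rfl, qprod_update c i le_rfl]
  have : P.rprod c (k + 1) = P.rprod c k * P.r c k := by
    unfold rprod
    rw [Finset.prod_range_succ]
  rw [this]
  simp only [Function.update_self, D]
  rw [mul_assoc, ← mul_div_mul_comm, mul_div_assoc]

theorem two_le {c : ℕ → ℕ} {k i : ℕ} (hi : P.r c k + 1 ≤ i) : (2 : ℝ) ≤ i := by
  have : 0 < P.r c k := P.φ_pos _
  have : 2 ≤ i := by omega
  exact_mod_cast this

theorem D_pos {c : ℕ → ℕ} {k : ℕ} (h : P.AdmissibleUpTo c k) : 0 < P.D c k := by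
  unfold D rprod qprod
  apply div_pos
  · exact Finset.prod_pos fun i _ => by have := P.r_pos c i; linarith
  · refine Finset.prod_pos fun i hi => ?_
    have := P.two_le (h i (Finset.mem_range.1 hi))
    apply mul_pos <;> linarith

theorem D_le {c : ℕ → ℕ} {k : ℕ} (h : P.AdmissibleUpTo c k) : P.D c k ≤ (1 / 2) ^ k := by
  have : P.D c k = ∏ i ∈ Finset.range k, ((P.r c i : ℝ) / (((c i : ℝ) - 1) * (c i : ℝ))) := by
    unfold D rprod qprod
    rw [Finset.prod_div_distrib]
  rw [this]
  calc _ ≤ ∏ i ∈ Finset.range k, (1 / 2 : ℝ) := by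
        refine Finset.prod_le_prod (fun i hi => ?_) (fun i hi => ?_)
        · have := P.two_le (h i (Finset.mem_range.1 hi))
          have : (0 : ℝ) ≤ (c i : ℝ) - 1 := by linarith
          positivity
        · have h2 := P.two_le (h i (Finset.mem_range.1 hi))
          have h3 : (P.r c i : ℝ) + 1 ≤ c i := by exact_mod_cast h i (Finset.mem_range.1 hi)
          have h4 := P.r_pos c i
          rw [div_le_div_iff₀ (by nlinarith) (by norm_num)]
          nlinarith
    _ = _ := by simp

theorem TT_update (c : ℕ → ℕ) {k i : ℕ} (hi : P.r c k + 1 ≤ i) (t : ℝ) :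
    P.TT (Function.update c k i) (k + 1)
      ((P.r c k / ((i : ℝ) - 1) - t) * ((((i : ℝ) - 1) * i) / P.r c k)) = P.TT c k t := by
  have h2 := P.two_le hi
  have h4 := P.r_pos c k
  have h5 : (i : ℝ) - 1 ≠ 0 := by linarith
  have h6 : (i : ℝ) ≠ 0 := by linarith
  have h7 : (P.r c k : ℝ) ≠ 0 := by linarith
  conv_lhs => unfold TT
  rw [A_update, D_update]
  unfold TT
  rw [pow_succ]
  field_simp
  ring

theorem D_update_mul (c : ℕ → ℕ) {k i : ℕ} (hi : P.r c k + 1 ≤ i) (x : ℝ) :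
    P.D (Function.update c k i) (k + 1) * (x * ((((i : ℝ) - 1) * i) / P.r c k)) =
      P.D c k * x := by
  have h2 := P.two_le hi
  have h4 := P.r_pos c k
  have h5 : (i : ℝ) - 1 ≠ 0 := by linarith
  have h6 : (i : ℝ) ≠ 0 := by linarith
  have h7 : (P.r c k : ℝ) ≠ 0 := by linarith
  rw [D_update]
  field_simp

theorem altEnd_update (c : ℕ → ℕ) {k i : ℕ} (hi : P.r c k + 1 ≤ i) :
    P.altEnd (Function.update c k i) (k + 1) = P.TT c k (P.r c k / (i : ℝ)) := by
  have h2 := P.two_le hi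
  have h5 : (i : ℝ) - 1 ≠ 0 := by linarith
  have h6 : (i : ℝ) ≠ 0 := by linarith
  unfold altEnd
  rw [A_update, D_update]
  unfold TT
  rw [pow_succ]
  field_simp
  ring

theorem mem_altCyl {c : ℕ → ℕ} {k i : ℕ} (h : P.AdmissibleUpTo c k) (hi : P.r c k + 1 ≤ i)
    {t : ℝ} (h1 : P.r c k / (i : ℝ) ≤ t) (h2 : t ≤ P.r c k / ((i : ℝ) - 1))
    (hx : P.TT c k t ∉ P.IS) : P.TT c k t ∈ P.altCyl (Function.update c k i) (k + 1) := by
  have hadm := P.adm_update h hi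
  have hD := P.D_pos h
  have e1 : t ≠ P.r c k / (i : ℝ) := by
    rintro rfl
    exact hx ⟨_, _, hadm, Or.inr (P.altEnd_update c hi).symm⟩
  have e2 : t ≠ P.r c k / ((i : ℝ) - 1) := by
    rintro rfl
    exact hx ⟨_, _, hadm, Or.inl (P.A_update c k i).symm⟩
  have h1 := lt_of_le_of_ne h1 e1.symm
  have h2 := lt_of_le_of_ne h2 e2
  refine ⟨?_, hx⟩
  rw [A_update, P.altEnd_update c hi, mem_Ioo, min_lt_iff, lt_max_iff]
  unfold TT
  have m1 := mul_lt_mul_of_pos_left h1 hD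
  have m2 := mul_lt_mul_of_pos_left h2 hD
  rcases neg_one_pow_eq_or ℝ k with hs | hs <;> rw [hs]
  · constructor
    · right; linarith
    · left; linarith
  · constructor
    · left; linarith
    · right; linarith

theorem altCyl_sub {c : ℕ → ℕ} {k i : ℕ} (h : P.AdmissibleUpTo c k) (hi : P.r c k + 1 ≤ i)
    {x : ℝ} (hx : x ∈ P.altCyl (Function.update c k i) (k + 1)) :
    ∃ t, P.r c k / (i : ℝ) ≤ t ∧ t ≤ P.r c k / ((i : ℝ) - 1) ∧ x = P.TT c k t := by
  have hD := P.D_pos h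
  have h2 := P.two_le hi
  obtain ⟨hx, -⟩ := hx
  have hle : (P.r c k : ℝ) / i ≤ P.r c k / ((i : ℝ) - 1) := by
    apply div_le_div_of_nonneg_left <;> first | positivity | linarith
  have m0 := mul_le_mul_of_nonneg_left hle hD.le
  rw [A_update, P.altEnd_update c hi, mem_Ioo, min_lt_iff, lt_max_iff] at hx
  unfold TT at hx ⊢
  refine ⟨(-1 : ℝ) ^ k * (x - P.A c k) / P.D c k, ?_⟩
  rw [le_div_iff₀ hD, div_le_iff₀ hD]
  rcases neg_one_pow_eq_or ℝ k with hs | hs <;> rw [hs] at hx ⊢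
  · refine ⟨?_, ?_, ?_⟩
    · rcases hx.1 with h | h <;> linarith
    · rcases hx.2 with h | h <;> linarith
    · field_simp; ring
  · refine ⟨?_, ?_, ?_⟩
    · rcases hx.2 with h | h <;> linarith
    · rcases hx.1 with h | h <;> linarith
    · field_simp; ring

/-- finite union -/
def fin (c : ℕ → ℕ) (k n m : ℕ) : Set ℝ :=
  ⋃ i ∈ Finset.Icc n m, P.altCyl (Function.update c k i) (k + 1)

/-- infinite union -/
def tl (c : ℕ → ℕ) (k n : ℕ) : Set ℝ :=
  ⋃ i ∈ {j : ℕ | n ≤ j}, P.altCyl (Function.update c k i) (k + 1)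

theorem diam_TT {c : ℕ → ℕ} {k : ℕ} (h : P.AdmissibleUpTo c k) {s : Set ℝ} {a b : ℝ}
    (hs : ∀ x ∈ s, ∃ t, a ≤ t ∧ t ≤ b ∧ x = P.TT c k t) :
    EMetric.diam s ≤ ENNReal.ofReal (P.D c k * (b - a)) := by
  have hD := P.D_pos h
  apply EMetric.diam_le
  intro x hx y hy
  obtain ⟨t, h1, h2, rfl⟩ := hs x hx
  obtain ⟨u, h3, h4, rfl⟩ := hs y hy
  rw [edist_dist, Real.dist_eq]
  apply ENNReal.ofReal_le_ofReal
  have : P.TT c k t - P.TT c k u = (-1) ^ k * (P.D c k * (t - u)) := by unfold TT; ring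
  rw [this, abs_mul, abs_pow, abs_neg, abs_one, one_pow, one_mul, abs_mul, abs_of_pos hD]
  apply mul_le_mul_of_nonneg_left _ hD.le
  rw [abs_le]; constructor <;> linarith

theorem fin_diam {c : ℕ → ℕ} {k n m : ℕ} (h : P.AdmissibleUpTo c k) (hn : P.r c k + 1 ≤ n) :
    EMetric.diam (P.fin c k n m) ≤
      ENNReal.ofReal (P.D c k * (P.r c k / ((n : ℝ) - 1) - P.r c k / (m : ℝ))) := by
  apply P.diam_TT h
  intro x hx
  simp only [fin, mem_iUnion, Finset.mem_Icc] at hx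
  obtain ⟨i, ⟨h1, h2⟩, hx⟩ := hx
  obtain ⟨t, h3, h4, rfl⟩ := P.altCyl_sub h (hn.trans h1) hx
  have hn2 := P.two_le hn
  have h1' : (n : ℝ) ≤ i := by exact_mod_cast h1
  have h2' : (i : ℝ) ≤ m := by exact_mod_cast h2
  refine ⟨t, le_trans ?_ h3, h4.trans ?_, rfl⟩
  · apply div_le_div_of_nonneg_left <;> first | positivity | linarith
  · apply div_le_div_of_nonneg_left <;> first | positivity | linarith

theorem tl_diam {c : ℕ → ℕ} {k n : ℕ} (h : P.AdmissibleUpTo c k) (hn : P.r c k + 1 ≤ n) :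
    EMetric.diam (P.tl c k n) ≤
      ENNReal.ofReal (P.D c k * (P.r c k / ((n : ℝ) - 1))) := by
  rw [← sub_zero ((P.r c k : ℝ) / ((n : ℝ) - 1))]
  apply P.diam_TT h
  intro x hx
  simp only [tl, mem_iUnion, mem_ofPred_eq] at hx
  obtain ⟨i, h1, hx⟩ := hx
  obtain ⟨t, h3, h4, rfl⟩ := P.altCyl_sub h (hn.trans h1) hx
  have hn2 := P.two_le hn
  have h1' : (n : ℝ) ≤ i := by exact_mod_cast h1
  refine ⟨t, le_trans ?_ h3, h4.trans ?_, rfl⟩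
  · positivity
  · apply div_le_div_of_nonneg_left <;> first | positivity | linarith

theorem digit_floor {ρ t : ℝ} (hρ : 1 ≤ ρ) (ht : 0 < t) :
    ∃ i : ℕ, ρ < t * i ∧ t * ((i : ℝ) - 1) ≤ ρ := by
  refine ⟨⌊ρ / t⌋₊ + 1, ?_, ?_⟩
  · have := Nat.lt_floor_add_one (ρ / t)
    rw [div_lt_iff₀ ht] at this
    push_cast; linarith
  · have := Nat.floor_le (a := ρ / t) (by positivity)
    rw [le_div_iff₀ ht] at this
    push_cast; linarith

theorem digit_ceil {ρ t : ℝ} (hρ : 1 ≤ ρ) (ht : 0 < t) :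
    ∃ i : ℕ, ρ ≤ t * i ∧ t * ((i : ℝ) - 1) < ρ := by
  refine ⟨⌈ρ / t⌉₊, ?_, ?_⟩
  · have := Nat.le_ceil (ρ / t)
    rw [div_le_iff₀ ht] at this
    linarith
  · have := Nat.ceil_lt_add_one (a := ρ / t) (by positivity)
    rw [← sub_lt_iff_lt_add, lt_div_iff₀ ht] at this
    linarith

theorem tl_mem {c : ℕ → ℕ} {k n : ℕ} (h : P.AdmissibleUpTo c k) (hn : P.r c k + 1 ≤ n) {t : ℝ}
    (h0 : 0 ≤ t) (h1 : t ≤ P.r c k / ((n : ℝ) - 1)) (hx : P.TT c k t ∉ P.IS) :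
    ∃ i, n ≤ i ∧ P.r c k < t * i ∧ P.TT c k t ∈ P.altCyl (Function.update c k i) (k + 1) ∧
      t * ((i : ℝ) - 1) ≤ P.r c k := by
  have hn2 := P.two_le hn
  have h0' : 0 < t := by
    refine lt_of_le_of_ne h0 ?_
    rintro rfl
    exact hx ⟨c, k, h, Or.inl (by simp [TT])⟩
  obtain ⟨i, hi1, hi2⟩ := digit_floor (P.r_pos c k) h0'
  rw [le_div_iff₀ (by linarith)] at h1
  have hni : n ≤ i := by
    have : (n : ℝ) - 1 < i := lt_of_mul_lt_mul_left (h1.trans_lt hi1) h0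
    have : (n : ℝ) < i + 1 := by linarith
    have : n < i + 1 := by exact_mod_cast this
    omega
  have h1' : (n : ℝ) ≤ i := by exact_mod_cast hni
  refine ⟨i, hni, hi1, P.mem_altCyl h (hn.trans hni) ?_ ?_ hx, hi2⟩
  · rw [div_le_iff₀ (by linarith)]; exact hi1.le
  · rw [le_div_iff₀ (by linarith)]; exact hi2

theorem mem_tl {c : ℕ → ℕ} {k n : ℕ} (h : P.AdmissibleUpTo c k) (hn : P.r c k + 1 ≤ n) {t : ℝ}
    (h0 : 0 ≤ t) (h1 : t ≤ P.r c k / ((n : ℝ) - 1)) (hx : P.TT c k t ∉ P.IS) :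
    P.TT c k t ∈ P.tl c k n := by
  obtain ⟨i, h2, -, h3, -⟩ := P.tl_mem h hn h0 h1 hx
  simp only [tl, mem_iUnion, mem_ofPred_eq]
  exact ⟨i, h2, h3⟩

theorem mem_fin {c : ℕ → ℕ} {k n m : ℕ} (h : P.AdmissibleUpTo c k) (hn : P.r c k + 1 ≤ n)
    (hnm : n ≤ m) {t : ℝ}
    (h0 : P.r c k / (m : ℝ) ≤ t) (h1 : t ≤ P.r c k / ((n : ℝ) - 1)) (hx : P.TT c k t ∉ P.IS) :
    P.TT c k t ∈ P.fin c k n m := by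
  have h00 : 0 ≤ t := le_trans (by positivity) h0
  obtain ⟨i, h2, h4, h3, h5⟩ := P.tl_mem h hn h00 h1 hx
  simp only [fin, mem_iUnion, Finset.mem_Icc]
  by_cases him : i ≤ m
  · exact ⟨i, ⟨h2, him⟩, h3⟩
  refine ⟨m, ⟨hnm, le_rfl⟩, P.mem_altCyl h (hn.trans hnm) h0 ?_ hx⟩
  have hm := P.two_le (hn.trans hnm)
  have : (m : ℝ) + 1 ≤ i := by exact_mod_cast (not_le.1 him)
  rw [le_div_iff₀ (by linarith)]
  nlinarith

theorem fin_mem_fam {c : ℕ → ℕ} {k n m : ℕ} (h : P.AdmissibleUpTo c k) (hn : P.r c k + 1 ≤ n)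
    (hnm : n ≤ m) : P.fin c k n m ∈ P.famAlt :=
  ⟨c, k, n, h, hn, Or.inl ⟨m, hnm, rfl⟩⟩

theorem tl_mem_fam {c : ℕ → ℕ} {k n : ℕ} (h : P.AdmissibleUpTo c k) (hn : P.r c k + 1 ≤ n) :
    P.tl c k n ∈ P.famAlt :=
  ⟨c, k, n, h, hn, Or.inr rfl⟩

theorem coverA {c : ℕ → ℕ} {k : ℕ} (h : P.AdmissibleUpTo c k) {v : ℝ} (h0 : 0 < v) (h1 : v ≤ 1) :
    ∃ V ∈ P.famAlt, EMetric.diam V ≤ ENNReal.ofReal (2 * (P.D c k * v)) ∧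
      ∀ t, 0 ≤ t → t ≤ v → P.TT c k t ∉ P.IS → P.TT c k t ∈ V := by
  obtain ⟨i, hi1, hi2⟩ := digit_floor (P.r_pos c k) h0
  have hi : P.r c k + 1 ≤ i := by
    have : (P.r c k : ℝ) < i := lt_of_lt_of_le hi1 (mul_le_of_le_one_left (by positivity) h1)
    exact_mod_cast this
  have h2 := P.two_le hi
  have hD := P.D_pos h
  refine ⟨_, P.tl_mem_fam h hi, (P.tl_diam h hi).trans (ENNReal.ofReal_le_ofReal ?_), ?_⟩
  · have : (P.r c k : ℝ) / ((i : ℝ) - 1) ≤ 2 * v := by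
      rw [div_le_iff₀ (by linarith)]
      nlinarith
    nlinarith
  · intro t ht0 ht1 hx
    refine P.mem_tl h hi ht0 (ht1.trans ?_) hx
    rw [le_div_iff₀ (by linarith)]; exact hi2

theorem coverL {c : ℕ → ℕ} {k i : ℕ} (h : P.AdmissibleUpTo c k) (hi : P.r c k ≤ i) {u : ℝ}
    (h0 : 0 ≤ u) (h1 : u < P.r c k / (i : ℝ)) :
    ∃ V ∈ P.famAlt, EMetric.diam V ≤ ENNReal.ofReal (2 * (P.D c k * (P.r c k / (i : ℝ) - u))) ∧
      ∀ t, u ≤ t → t ≤ P.r c k / (i : ℝ) → P.TT c k t ∉ P.IS → P.TT c k t ∈ V := by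
  have hD := P.D_pos h
  have hr := P.r_pos c k
  have hi' : P.r c k + 1 ≤ i + 1 := by omega
  have hir : (P.r c k : ℝ) ≤ i := by exact_mod_cast hi
  have hc : (((i + 1 : ℕ) : ℝ) - 1) = i := by push_cast; ring
  rcases h0.eq_or_lt with rfl | h0'
  · refine ⟨_, P.tl_mem_fam h hi', (P.tl_diam h hi').trans (ENNReal.ofReal_le_ofReal ?_), ?_⟩
    · rw [hc]
      have : 0 < P.D c k * ((P.r c k : ℝ) / i) := mul_pos hD h1
      linarith
    · intro t ht0 ht1 hx
      refine P.mem_tl h hi' ht0 (ht1.trans ?_) hx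
      rw [hc]
  obtain ⟨j, hj1, hj2⟩ := digit_ceil hr h0'
  have hipos : (0 : ℝ) < i := by linarith
  have hij : i + 1 ≤ j := by
    rw [lt_div_iff₀ hipos] at h1
    have : (i : ℝ) < j := lt_of_mul_lt_mul_left (h1.trans_le hj1) h0
    exact_mod_cast this
  have hjpos : (0 : ℝ) < j := by
    have : 0 < j := by omega
    exact_mod_cast this
  rcases hij.eq_or_lt with rfl | hij2
  · have hadm := P.adm_update h hi'
    have e1 := P.TT_update c hi'
    have e2 := P.D_update_mul c hi'
    rw [hc] at e1 e2
    have hpos : (0 : ℝ) < ((i : ℝ) * ((i + 1 : ℕ) : ℝ)) / P.r c k := by positivity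
    obtain ⟨V, hV, hd, hm⟩ := P.coverA hadm
      (v := ((P.r c k : ℝ) / i - u) * (((i : ℝ) * ((i + 1 : ℕ) : ℝ)) / P.r c k))
      (mul_pos (by linarith) hpos) (by
        have e : (P.r c k : ℝ) / i - P.r c k / ((i + 1 : ℕ) : ℝ) ≥ P.r c k / i - u := by
          have : (P.r c k : ℝ) / ((i + 1 : ℕ) : ℝ) ≤ u := by
            rw [div_le_iff₀ hjpos]; exact hj1
          linarith
        refine (mul_le_mul_of_nonneg_right e hpos.le).trans (le_of_eq ?_)
        push_cast
        have : (i : ℝ) + 1 ≠ 0 := by linarith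
        field_simp
        ring)
    rw [e2] at hd
    refine ⟨V, hV, hd, ?_⟩
    intro t ht0 ht1 hx
    rw [← e1 t] at hx ⊢
    refine hm _ (mul_nonneg (by linarith) hpos.le) ?_ hx
    exact mul_le_mul_of_nonneg_right (by linarith) hpos.le
  · refine ⟨_, P.fin_mem_fam h hi' hij, (P.fin_diam h hi').trans (ENNReal.ofReal_le_ofReal ?_), ?_⟩
    · rw [hc]
      have hij3 : (i : ℝ) + 2 ≤ j := by exact_mod_cast hij2
      have hu : u < (P.r c k : ℝ) / (j - 1) := by
        rw [lt_div_iff₀ (by linarith)]; exact hj2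
      have key : (P.r c k : ℝ) / i - P.r c k / j ≤ 2 * (P.r c k / i - P.r c k / (j - 1)) := by
        have hj0 : (0 : ℝ) < j - 1 := by linarith
        have e : 2 * ((P.r c k : ℝ) / i - P.r c k / (j - 1)) - (P.r c k / i - P.r c k / j) =
            P.r c k * ((j * ((j : ℝ) - 1) - i * (j + 1)) / (i * j * (j - 1))) := by
          field_simp; ring
        have : 0 ≤ 2 * ((P.r c k : ℝ) / i - P.r c k / (j - 1)) - (P.r c k / i - P.r c k / j) := by
          rw [e]
          apply mul_nonneg (by linarith)
          apply div_nonneg _ (by positivity)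
          nlinarith
        linarith
      have := mul_le_mul_of_nonneg_left (key.trans (b := _)
        (c := 2 * ((P.r c k : ℝ) / i - u)) (by linarith)) hD.le
      linarith
    · intro t ht0 ht1 hx
      refine P.mem_fin h hi' hij ?_ ?_ hx
      · refine le_trans ?_ ht0
        rw [div_le_iff₀ hjpos]; exact hj1
      · rw [hc]; exact ht1

/-- conclusion for an interval -/
def Concl (a b : ℝ) : Prop := ∃ V₁ ∈ P.famAlt, ∃ V₂ ∈ P.famAlt,
  EMetric.diam V₁ ≤ ENNReal.ofReal (2 * (b - a)) ∧ EMetric.diam V₂ ≤ ENNReal.ofReal (2 * (b - a)) ∧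
    Icc a b \ P.IS ⊆ V₁ ∪ V₂

/-- the cylinder contains the interval -/
def Cont (a b : ℝ) (c : ℕ → ℕ) (k : ℕ) : Prop := P.AdmissibleUpTo c k ∧ ∃ u v : ℝ, 0 ≤ u ∧ u < v ∧
  v ≤ 1 ∧ P.D c k * (v - u) = b - a ∧ ∀ x ∈ Icc a b, ∃ t ∈ Icc u v, x = P.TT c k t

theorem step {a b : ℝ} {c : ℕ → ℕ} {k : ℕ} (h : P.Cont a b c k) :
    P.Concl a b ∨ ∃ c', P.Cont a b c' (k + 1) := by
  obtain ⟨h, u, v, hu, huv, hv, hlen, hx⟩ := h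
  have hv0 : 0 < v := by linarith
  have hD := P.D_pos h
  have hr := P.r_pos c k
  obtain ⟨i, hi1, hi2⟩ := digit_floor hr hv0
  have hi : P.r c k + 1 ≤ i := by
    have : (P.r c k : ℝ) < i := lt_of_lt_of_le hi1 (mul_le_of_le_one_left (by positivity) hv)
    exact_mod_cast this
  have h2 := P.two_le hi
  have hadm := P.adm_update h hi
  have e1 := P.TT_update c hi
  have e2 := P.D_update_mul c hi
  have hpos : (0 : ℝ) < (((i : ℝ) - 1) * i) / P.r c k := by
    have : 0 < (i : ℝ) - 1 := by linarith
    positivity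
  have e3 : ((P.r c k : ℝ) / ((i : ℝ) - 1) - P.r c k / i) * ((((i : ℝ) - 1) * i) / P.r c k) = 1 := by
    have : (i : ℝ) - 1 ≠ 0 := by linarith
    field_simp
    ring
  set κ := (((i : ℝ) - 1) * i) / P.r c k with hκ
  have hp : (P.r c k : ℝ) / i < v := by rw [div_lt_iff₀ (by linarith)]; exact hi1
  have hq : v ≤ (P.r c k : ℝ) / (i - 1) := by rw [le_div_iff₀ (by linarith)]; exact hi2
  set p := (P.r c k : ℝ) / i with hpdef
  set q := (P.r c k : ℝ) / (i - 1) with hqdef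
  rcases le_or_gt p u with hpu | hpu
  · right
    refine ⟨_, hadm, (q - v) * κ, (q - u) * κ, ?_, ?_, ?_, ?_, ?_⟩
    · exact mul_nonneg (by linarith) hpos.le
    · exact mul_lt_mul_of_pos_right (by linarith) hpos
    · rw [← e3]; exact mul_le_mul_of_nonneg_right (by linarith) hpos.le
    · rw [← hlen, ← e2]; ring
    · intro x hx'
      obtain ⟨t, ⟨ht1, ht2⟩, rfl⟩ := hx x hx'
      refine ⟨(q - t) * κ, ⟨?_, ?_⟩, (e1 t).symm⟩
      · exact mul_le_mul_of_nonneg_right (by linarith) hpos.le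
      · exact mul_le_mul_of_nonneg_right (by linarith) hpos.le
  · left
    obtain ⟨V₁, hV₁, hd₁, hm₁⟩ := P.coverL h (by omega : P.r c k ≤ i) hu hpu
    have hr' := P.r_pos (Function.update c k i) (k + 1)
    have hone : (P.r (Function.update c k i) (k + 1) : ℝ) / P.r (Function.update c k i) (k + 1)
      = 1 := div_self (by linarith)
    obtain ⟨V₂, hV₂, hd₂, hm₂⟩ := P.coverL hadm le_rfl (u := (q - v) * κ)
      (mul_nonneg (by linarith) hpos.le) (by
        rw [hone, ← e3]
        exact mul_lt_mul_of_pos_right (by linarith) hpos)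
    rw [hone] at hd₂ hm₂
    refine ⟨V₁, hV₁, V₂, hV₂, hd₁.trans (ENNReal.ofReal_le_ofReal ?_),
      hd₂.trans (ENNReal.ofReal_le_ofReal ?_), ?_⟩
    · rw [← hlen]
      have := mul_le_mul_of_nonneg_left (by linarith : p - u ≤ v - u) hD.le
      linarith
    · rw [← hlen, ← e3, ← sub_mul, e2]
      have := mul_le_mul_of_nonneg_left (by linarith : (q - p) - (q - v) ≤ v - u) hD.le
      linarith
    · rintro x ⟨hxJ, hxI⟩
      obtain ⟨t, ⟨ht1, ht2⟩, rfl⟩ := hx x hxJ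
      rcases le_total t p with htp | htp
      · left; exact hm₁ t ht1 htp hxI
      · right
        rw [← e1 t] at hxI ⊢
        refine hm₂ _ ?_ ?_ hxI
        · exact mul_le_mul_of_nonneg_right (by linarith) hpos.le
        · rw [← e3]; exact mul_le_mul_of_nonneg_right (by linarith) hpos.le

theorem concl {a b : ℝ} (ha : 0 ≤ a) (hab : a < b) (hb : b ≤ 1) : P.Concl a b := by
  by_contra hcon
  have key : ∀ k, ∃ c, P.Cont a b c k := by
    intro k
    induction k with
    | zero =>
      refine ⟨fun _ => 0, fun i hi => absurd hi (by omega), a, b, ha, hab, hb, ?_, ?_⟩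
      · simp [D, rprod, qprod]
      · intro x hx
        exact ⟨x, hx, by simp [TT, A, D, rprod, qprod]⟩
    | succ k ih =>
      obtain ⟨c, hc⟩ := ih
      exact (P.step hc).resolve_left hcon
  obtain ⟨k, hk⟩ := exists_pow_lt_of_lt_one (sub_pos.2 hab) (by norm_num : (1 / 2 : ℝ) < 1)
  obtain ⟨c, h, u, v, hu, huv, hv, hlen, -⟩ := key k
  have h1 := P.D_le h
  have h2 := P.D_pos h
  have : P.D c k * (v - u) ≤ P.D c k * 1 := mul_le_mul_of_nonneg_left (by linarith) h2.le
  linarith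

/-- covering a small set by two members of the family -/
theorem cover_set {S : Set ℝ} (hS : S ⊆ Ioo 0 1 \ P.IS) {δ : ℝ} (hδ : 0 < δ)
    (hd : EMetric.diam S ≤ ENNReal.ofReal δ) :
    ∃ V : Bool → Set ℝ, (∀ b, V b ∈ P.famAlt) ∧
      (∀ b, EMetric.diam (V b) ≤ ENNReal.ofReal (4 * δ)) ∧ S ⊆ ⋃ b, V b := by
  obtain ⟨x, hx01, hx⟩ : ∃ x ∈ Ioo (0 : ℝ) 1, ∀ y ∈ S, |y - x| ≤ δ := by
    rcases S.eq_empty_or_nonempty with rfl | ⟨x, hx⟩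
    · exact ⟨1 / 2, by norm_num, by simp⟩
    · refine ⟨x, (hS hx).1, fun y hy => ?_⟩
      have := (EMetric.edist_le_diam_of_mem hy hx).trans hd
      rw [edist_dist, ENNReal.ofReal_le_ofReal_iff hδ.le, Real.dist_eq] at this
      exact this
  obtain ⟨V₁, hV₁, V₂, hV₂, hd₁, hd₂, hsub⟩ := P.concl (a := max 0 (x - δ)) (b := min 1 (x + δ))
    (le_max_left _ _) (by
      rw [max_lt_iff, lt_min_iff, lt_min_iff]
      refine ⟨⟨?_, ?_⟩, ?_, ?_⟩ <;> linarith [hx01.1, hx01.2]) (min_le_left _ _)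
  have hl : 2 * (min 1 (x + δ) - max 0 (x - δ)) ≤ 4 * δ := by
    have := min_le_right 1 (x + δ)
    have := le_max_right 0 (x - δ)
    linarith
  refine ⟨fun b => cond b V₁ V₂, ?_, ?_, ?_⟩
  · rintro (_ | _) <;> simpa
  · rintro (_ | _)
    · exact hd₂.trans (ENNReal.ofReal_le_ofReal hl)
    · exact hd₁.trans (ENNReal.ofReal_le_ofReal hl)
  · intro y hy
    have h1 := abs_le.1 (hx y hy)
    have h2 := hS hy
    have := hsub ⟨⟨max_le h2.1.1.le (by linarith), le_min h2.1.2.le (by linarith)⟩, h2.2⟩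
    rw [mem_iUnion]
    rcases this with h | h
    · exact ⟨true, h⟩
    · exact ⟨false, h⟩

end PerronSystem

/-- the pre-measure at scale `ε` -/
noncomputable def preH (Φ : Set (Set ℝ)) (α : ℝ) (E : Set ℝ) (ε : ℝ) : ℝ≥0∞ :=
  ⨅ (f : ℕ → Set ℝ) (_ : E ⊆ ⋃ n, f n) (_ : ∀ n, f n ∈ Φ)
      (_ : ∀ n, EMetric.diam (f n) ≤ ENNReal.ofReal ε),
      ∑' n : ℕ, EMetric.diam (f n) ^ α

theorem preH_le {Φ : Set (Set ℝ)} {α : ℝ} {E : Set ℝ} {ε : ℝ} {ι : Type} [Denumerable ι]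
    (f : ι → Set ℝ) (h1 : E ⊆ ⋃ n, f n) (h2 : ∀ n, f n ∈ Φ)
    (h3 : ∀ n, EMetric.diam (f n) ≤ ENNReal.ofReal ε) :
    preH Φ α E ε ≤ ∑' n, EMetric.diam (f n) ^ α := by
  rw [← (Denumerable.eqv ι).symm.tsum_eq]
  unfold preH
  refine iInf_le_of_le (fun n => f ((Denumerable.eqv ι).symm n)) ?_
  refine iInf_le_of_le ?_ (iInf_le_of_le (fun n => h2 _) (iInf_le_of_le (fun n => h3 _) le_rfl))
  rwa [(Denumerable.eqv ι).symm.surjective.iUnion_comp f]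

theorem small_pow {α : ℝ} (hα : 0 < α) {η : ℝ≥0∞} (hη : 0 < η) {u : ℕ → ℝ}
    (hu : Tendsto u atTop (nhds 0)) : ∀ᶠ n in atTop, ENNReal.ofReal (u n) ^ α ≤ η := by
  have h1 : Tendsto (fun n => ENNReal.ofReal (u n) ^ α) atTop (nhds 0) := by
    have := (ENNReal.continuous_rpow_const (y := α)).tendsto (ENNReal.ofReal 0)
    rw [ENNReal.ofReal_zero, ENNReal.zero_rpow_of_pos hα, ← ENNReal.ofReal_zero] at this
    have h2 := this.comp ((ENNReal.continuous_ofReal.tendsto 0).comp hu)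
    rw [ENNReal.ofReal_zero] at h2
    exact h2
  exact (h1.eventually_lt_const hη).mono fun _ h => h.le

namespace PerronSystem

variable (P : PerronSystem)

theorem tails {c : ℕ → ℕ} {k : ℕ} {α : ℝ} (hα : 0 < α) {ε : ℝ} (hε : 0 < ε) (n : ℕ)
    {η : ℕ → ℝ≥0∞} (hη : ∀ j, 0 < η j) : ∃ φ : ℕ → ℕ, StrictMono φ ∧ ∀ j, n ≤ φ j ∧
      ENNReal.ofReal (P.D c k * (P.r c k / ((φ j : ℝ) - 1))) ≤ ENNReal.ofReal ε ∧
      ENNReal.ofReal (P.D c k * (P.r c k / ((φ j : ℝ) - 1))) ^ α ≤ η j := by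
  have ht : Tendsto (fun N : ℕ => P.D c k * (P.r c k / ((N : ℝ) - 1))) atTop (nhds 0) := by
    rw [← mul_zero (P.D c k)]
    apply Tendsto.const_mul
    apply Tendsto.const_div_atTop
    exact tendsto_atTop_add_const_right _ _ tendsto_natCast_atTop_atTop
  refine Filter.extraction_forall_of_eventually (P := fun j N => n ≤ N ∧
      ENNReal.ofReal (P.D c k * (P.r c k / ((N : ℝ) - 1))) ≤ ENNReal.ofReal ε ∧
      ENNReal.ofReal (P.D c k * (P.r c k / ((N : ℝ) - 1))) ^ α ≤ η j) ?_
  intro j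
  filter_upwards [eventually_ge_atTop n, small_pow hα (hη j) ht,
    ht.eventually_lt_const hε] with N h1 h2 h3
  exact ⟨h1, ENNReal.ofReal_le_ofReal h3.le, h2⟩

theorem tl_sub (c : ℕ → ℕ) (k : ℕ) {φ : ℕ → ℕ} (hφ : StrictMono φ) :
    P.tl c k (φ 0) ⊆ ⋃ j, P.fin c k (φ j) (φ (j + 1)) := by
  intro x hx
  simp only [tl, fin, mem_iUnion, mem_ofPred_eq, Finset.mem_Icc] at hx ⊢
  obtain ⟨i, hi, hx⟩ := hx
  classical
  have hex : ∃ j, i ≤ φ (j + 1) := ⟨i, (hφ.id_le i).trans (hφ (Nat.lt_succ_self i)).le⟩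
  refine ⟨Nat.find hex, i, ⟨?_, Nat.find_spec hex⟩, hx⟩
  rcases Nat.eq_zero_or_eq_succ_pred (Nat.find hex) with h0 | h0
  · rw [h0]; exact hi
  · rw [h0]
    have := Nat.find_min hex (m := (Nat.find hex).pred) (by omega)
    exact (not_le.1 this).le

theorem split {U : Set ℝ} (hU : U ∈ P.famAlt) {α : ℝ} (hα : 0 < α) {ε : ℝ} (hε : 0 < ε)
    (hd : EMetric.diam U ≤ ENNReal.ofReal ε) {η : ℝ≥0∞} (hη : η ≠ 0) :
    ∃ g : ℕ → Set ℝ, U ⊆ (⋃ j, g j) ∧ (∀ j, g j ∈ P.famAlt1) ∧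
      (∀ j, EMetric.diam (g j) ≤ ENNReal.ofReal ε) ∧
      ∑' j, EMetric.diam (g j) ^ α ≤ EMetric.diam U ^ α + η := by
  obtain ⟨c, k, n, h, hn, hU⟩ := hU
  obtain ⟨η', hη', hsum⟩ := ENNReal.exists_pos_sum_of_countable' hη ℕ
  obtain ⟨φ, hφ, hφ'⟩ := P.tails (c := c) (k := k) hα hε n hη'
  have hD := P.D_pos h
  obtain ⟨W, hW, hWU, hUW⟩ : ∃ W ∈ P.famAlt1, W ⊆ U ∧ U ⊆ W ∪ P.tl c k (φ 0) := by
    rcases hU with ⟨m, hm, rfl⟩ | rfl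
    · exact ⟨_, ⟨c, k, n, m, h, hn, hm, rfl⟩, Subset.rfl, subset_union_left⟩
    · refine ⟨P.fin c k n (φ 0), ⟨c, k, n, φ 0, h, hn, (hφ' 0).1, rfl⟩, ?_, ?_⟩
      · intro x hx
        simp only [fin, mem_iUnion, mem_ofPred_eq, Finset.mem_Icc] at hx ⊢
        obtain ⟨i, hi, hx⟩ := hx
        exact ⟨i, hi.1, hx⟩
      · intro x hx
        simp only [fin, tl, mem_union, mem_iUnion, mem_ofPred_eq, Finset.mem_Icc] at hx ⊢
        obtain ⟨i, hi, hx⟩ := hx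
        rcases le_total i (φ 0) with h1 | h1
        · exact Or.inl ⟨i, ⟨hi, h1⟩, hx⟩
        · exact Or.inr ⟨i, h1, hx⟩
  have hb : ∀ j, EMetric.diam (P.fin c k (φ j) (φ (j + 1))) ≤
      ENNReal.ofReal (P.D c k * (P.r c k / ((φ j : ℝ) - 1))) := by
    intro j
    refine (P.fin_diam h (hn.trans (hφ' j).1)).trans (ENNReal.ofReal_le_ofReal ?_)
    apply mul_le_mul_of_nonneg_left _ hD.le
    have : (0 : ℝ) ≤ (P.r c k : ℝ) / (φ (j + 1) : ℝ) := by positivity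
    linarith
  let g : ℕ → Set ℝ := fun j => Nat.casesOn j W (fun j => P.fin c k (φ j) (φ (j + 1)))
  refine ⟨g, ?_, ?_, ?_, ?_⟩
  · intro x hx
    rcases hUW hx with h1 | h1
    · exact mem_iUnion.2 ⟨0, h1⟩
    · obtain ⟨j, hj⟩ := mem_iUnion.1 (P.tl_sub c k hφ h1)
      exact mem_iUnion.2 ⟨j + 1, hj⟩
  · rintro (_ | j)
    · exact hW
    · exact ⟨c, k, φ j, φ (j + 1), h, hn.trans (hφ' j).1, (hφ (Nat.lt_succ_self j)).le, rfl⟩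
  · rintro (_ | j)
    · exact (EMetric.diam_mono hWU).trans hd
    · exact (hb j).trans (hφ' j).2.1
  · rw [tsum_eq_zero_add' ENNReal.summable]
    refine add_le_add (ENNReal.rpow_le_rpow (EMetric.diam_mono hWU) hα.le) ?_
    refine le_trans (ENNReal.tsum_le_tsum fun j => ?_) hsum.le
    exact (ENNReal.rpow_le_rpow (hb j) hα.le).trans (hφ' j).2.2

theorem famAlt1_sub : P.famAlt1 ⊆ P.famAlt := by
  rintro U ⟨c, k, n, m, h, hn, hm, rfl⟩
  exact ⟨c, k, n, h, hn, Or.inl ⟨m, hm, rfl⟩⟩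

theorem Hfam_eq (E : Set ℝ) {α : ℝ} (hα : 0 < α) :
    Hfam P.famAlt1 α E = Hfam P.famAlt α E := by
  change (⨆ (ε : ℝ) (_ : 0 < ε), preH P.famAlt1 α E ε) = ⨆ (ε : ℝ) (_ : 0 < ε), preH P.famAlt α E ε
  refine iSup_congr fun ε => iSup_congr fun hε => le_antisymm ?_ ?_
  · conv_rhs => unfold preH
    refine le_iInf fun f => le_iInf fun h1 => le_iInf fun h2 => le_iInf fun h3 => ?_
    refine ENNReal.le_of_forall_pos_le_add fun η hη _ => ?_
    obtain ⟨η', hη', hsum⟩ := ENNReal.exists_pos_sum_of_countable'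
      (ENNReal.coe_ne_zero.2 hη.ne') ℕ
    choose g hg1 hg2 hg3 hg4 using fun n => P.split (h2 n) hα hε (h3 n) (hη' n).ne'
    refine (preH_le (fun p : ℕ × ℕ => g p.1 p.2) ?_ (fun p => hg2 _ _) (fun p => hg3 _ _)).trans ?_
    · intro x hx
      obtain ⟨n, hn⟩ := mem_iUnion.1 (h1 hx)
      obtain ⟨j, hj⟩ := mem_iUnion.1 (hg1 n hn)
      exact mem_iUnion.2 ⟨(n, j), hj⟩
    · rw [ENNReal.tsum_prod']
      refine (ENNReal.tsum_le_tsum hg4).trans ?_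
      rw [ENNReal.tsum_add]
      gcongr
  · conv_rhs => unfold preH
    refine le_iInf fun f => le_iInf fun h1 => le_iInf fun h2 => le_iInf fun h3 => ?_
    exact preH_le f h1 (fun n => P.famAlt1_sub (h2 n)) h3

theorem Hfam_zero {E : Set ℝ} (hE : E ⊆ Ioo 0 1 \ P.IS) {α : ℝ} (hα : 0 < α)
    (h0 : μH[α] E = 0) : Hfam P.famAlt α E = 0 := by
  change (⨆ (ε : ℝ) (_ : 0 < ε), preH P.famAlt α E ε) = 0
  rw [ENNReal.iSup_eq_zero]
  intro ε
  rw [ENNReal.iSup_eq_zero]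
  intro hε
  rw [Measure.hausdorffMeasure_apply, ENNReal.iSup_eq_zero] at h0
  have h0 := h0 (ENNReal.ofReal (ε / 4))
  rw [ENNReal.iSup_eq_zero] at h0
  have h0 := h0 (ENNReal.ofReal_pos.2 (by linarith))
  have key : ∀ η : NNReal, 0 < η → preH P.famAlt α E ε ≤
      2 * (ENNReal.ofReal 4 ^ α * (η + η)) := by
    intro η hη
    have hη0 : (0 : ℝ≥0∞) < η := ENNReal.coe_pos.2 hη
    obtain ⟨η', hη', hsum⟩ := ENNReal.exists_pos_sum_of_countable' hη0.ne' ℕ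
    have hlt := hη0
    rw [← h0] at hlt
    simp only [iInf_lt_iff] at hlt
    obtain ⟨t, ht1, ht2, ht3⟩ := hlt
    have hδ : ∀ n, ∃ δ : ℝ, 0 < δ ∧ EMetric.diam (E ∩ t n) ≤ ENNReal.ofReal δ ∧
        4 * δ ≤ ε ∧ ENNReal.ofReal δ ^ α ≤
          (⨆ _ : (t n).Nonempty, EMetric.diam (t n) ^ α) + η' n := by
      intro n
      have hfin : EMetric.diam (t n) ≠ ∞ := ne_top_of_le_ne_top ENNReal.ofReal_ne_top (ht2 n)
      rcases eq_or_ne (EMetric.diam (t n)) 0 with hz | hz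
      · have ht : Tendsto (fun N : ℕ => 1 / ((N : ℝ) + 1)) atTop (nhds 0) :=
          tendsto_one_div_add_atTop_nhds_zero_nat
        obtain ⟨N, hN1, hN2⟩ := ((small_pow hα (hη' n) ht).and
          (ht.eventually_lt_const (by linarith : (0 : ℝ) < ε / 4))).exists
        refine ⟨1 / ((N : ℝ) + 1), by positivity, ?_, by linarith, hN1.trans le_add_self⟩
        refine (EMetric.diam_mono inter_subset_right).trans ?_
        exact hz.le.trans zero_le
      · refine ⟨(EMetric.diam (t n)).toReal, ENNReal.toReal_pos hz hfin, ?_, ?_, ?_⟩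
        · rw [ENNReal.ofReal_toReal hfin]
          exact EMetric.diam_mono inter_subset_right
        · have := ENNReal.toReal_mono ENNReal.ofReal_ne_top (ht2 n)
          rw [ENNReal.toReal_ofReal (by linarith)] at this
          change (EMetric.diam (t n)).toReal ≤ _ at this
          linarith
        · rw [ENNReal.ofReal_toReal hfin]
          have hne : (t n).Nonempty := by
            rw [nonempty_iff_ne_empty]
            intro he
            rw [he] at hz
            exact hz EMetric.diam_empty
          rw [iSup_pos hne]
          exact le_self_add
    choose δ hδ0 hδ1 hδ2 hδ3 using hδ
    choose V hV1 hV2 hV3 using fun n =>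
      P.cover_set (S := E ∩ t n) (inter_subset_left.trans hE) (hδ0 n) (hδ1 n)
    haveI : Denumerable (ℕ × Bool) := Denumerable.ofEncodableOfInfinite (ℕ × Bool)
    refine (preH_le (fun p : ℕ × Bool => V p.1 p.2) ?_ (fun p => hV1 _ _) (fun p =>
      (hV2 _ _).trans (ENNReal.ofReal_le_ofReal (hδ2 _)))).trans ?_
    · intro x hx
      obtain ⟨n, hn⟩ := mem_iUnion.1 (ht1 hx)
      obtain ⟨j, hj⟩ := mem_iUnion.1 (hV3 n ⟨hx, hn⟩)
      exact mem_iUnion.2 ⟨(n, j), hj⟩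
    · rw [ENNReal.tsum_prod']
      calc _ ≤ ∑' n, 2 * (ENNReal.ofReal 4 ^ α *
            ((⨆ _ : (t n).Nonempty, EMetric.diam (t n) ^ α) + η' n)) := by
            refine ENNReal.tsum_le_tsum fun n => ?_
            have hb : ∀ b, EMetric.diam (V n b) ^ α ≤ ENNReal.ofReal 4 ^ α *
                ((⨆ _ : (t n).Nonempty, EMetric.diam (t n) ^ α) + η' n) := by
              intro b
              refine (ENNReal.rpow_le_rpow (hV2 n b) hα.le).trans ?_
              rw [ENNReal.ofReal_mul (by norm_num), ENNReal.mul_rpow_of_nonneg _ _ hα.le]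
              gcongr
              exact hδ3 n
            rw [tsum_fintype, Fintype.sum_bool, two_mul]
            exact add_le_add (hb _) (hb _)
        _ ≤ _ := by
            rw [ENNReal.tsum_mul_left, ENNReal.tsum_mul_left, ENNReal.tsum_add]
            gcongr
            exact ht3.le
  by_contra hne
  have hpos : 0 < preH P.famAlt α E ε := pos_iff_ne_zero.2 hne
  set K : ℝ≥0∞ := 4 * ENNReal.ofReal 4 ^ α with hK
  have hK1 : K ≠ ∞ := ENNReal.mul_ne_top (by norm_num)
    (ENNReal.rpow_ne_top_of_nonneg hα.le ENNReal.ofReal_ne_top)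
  obtain ⟨x, hx0, hx⟩ : ∃ x : NNReal, 0 < x ∧ K * x < preH P.famAlt α E ε := by
    have ht : Tendsto (fun x : ℝ≥0∞ => K * x) (nhds 0) (nhds (K * 0)) :=
      ENNReal.Tendsto.const_mul tendsto_id (Or.inr hK1)
    rw [mul_zero] at ht
    obtain ⟨y, hy, hy2⟩ := ENNReal.nhds_zero_basis.eventually_iff.1 (ht.eventually_lt_const hpos)
    obtain ⟨x, hx1, hx2⟩ := ENNReal.lt_iff_exists_nnreal_btwn.1 hy
    exact ⟨x, ENNReal.coe_pos.1 hx1, hy2 hx2⟩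
  refine absurd (key x hx0) (not_le.2 (lt_of_le_of_lt (le_of_eq ?_) hx))
  rw [hK]; ring

theorem hausdorff_le {Φ : Set (Set ℝ)} {E : Set ℝ} {α : ℝ} : μH[α] E ≤ Hfam Φ α E := by
  change _ ≤ (⨆ (ε : ℝ) (_ : 0 < ε), preH Φ α E ε)
  rw [Measure.hausdorffMeasure_apply]
  refine iSup_le fun r => iSup_le fun hr => ?_
  obtain ⟨x, hx1, hx2⟩ := ENNReal.lt_iff_exists_nnreal_btwn.1 hr
  refine le_trans ?_ (le_iSup₂_of_le (x : ℝ) (NNReal.coe_pos.2 (ENNReal.coe_pos.1 hx1)) le_rfl)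
  unfold preH
  refine le_iInf fun f => le_iInf fun h1 => le_iInf fun h2 => le_iInf fun h3 => ?_
  refine iInf_le_of_le f (iInf_le_of_le h1 (iInf_le_of_le (fun n => ?_) ?_))
  · refine (h3 n).trans ?_
    rw [ENNReal.ofReal_coe_nnreal]; exact hx2.le
  · exact ENNReal.tsum_le_tsum fun n => iSup_le fun _ => le_rfl

theorem dim_eq {E : Set ℝ} (hE : E ⊆ Ioo 0 1 \ P.IS) : dimFam P.famAlt1 E = dimH E := by
  unfold dimFam
  apply le_antisymm
  · refine le_of_forall_gt_imp_ge_of_dense fun a ha => ?_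
    obtain ⟨x, hx1, hx2⟩ := ENNReal.lt_iff_exists_nnreal_btwn.1 ha
    have hx0 : (0 : ℝ) < x := NNReal.coe_pos.2 (ENNReal.coe_pos.1 (lt_of_le_of_lt zero_le hx1))
    refine le_trans ?_ hx2.le
    refine iInf_le_of_le (x : ℝ) (iInf_le_of_le hx0 (iInf_le_of_le ?_ ?_))
    · rw [P.Hfam_eq E hx0]
      exact P.Hfam_zero hE hx0 (hausdorffMeasure_of_dimH_lt hx1)
    · rw [ENNReal.ofReal_coe_nnreal]
  · refine le_iInf fun α => le_iInf fun hα => le_iInf fun h => ?_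
    have h1 : μH[α] E = 0 := le_antisymm (hausdorff_le.trans h.le) zero_le
    apply dimH_le_of_hausdorffMeasure_ne_top
    rw [Real.coe_toNNReal _ hα.le, h1]
    exact ENNReal.zero_ne_top

end PerronSystem

/-- `H^α(E,𝔓₁⁻) = H^α(E,𝔓⁻)` for every `E ⊆ (0,1) \ IS^{P⁻}` and `α > 0`, and
the family `𝔓₁⁻` of finite unions of consecutive alternating cylinders is faithful for the
Hausdorff dimension calculation on `(0,1) \ IS^{P⁻}`. -/
theorem famAlt1_faithful (P : PerronSystem) :
    (∀ E : Set ℝ, E ⊆ Set.Ioo 0 1 \ P.IS → ∀ α : ℝ, 0 < α →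
      Hfam P.famAlt1 α E = Hfam P.famAlt α E) ∧
    (∀ E : Set ℝ, E ⊆ Set.Ioo 0 1 \ P.IS → dimFam P.famAlt1 E = dimH E) := by
  exact ⟨fun E _ α hα => P.Hfam_eq E hα, fun E hE => P.dim_eq hE⟩
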